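/- arXiv:math/0309165 — 2 statements merged into one kernel-verified Lean document; each statement's English description precedes it below -/
import Mathlib

section
/- The theory T has the following properties: (1) T is consistent and has no finite models; (2) T has elimination of quantifiers, i.e. every L-formula is, modulo T, equivalent to a quantifier-free formula; (3) T is complete; (4) T is ω-categorical (it has, up to isomorphism, exactly one countable model). -/
open FirstOrder

open FirstOrder.Language

/-- The language with exactly one relation symbol of arity `m` for each
`m ≥ 1` (the symbol of arity `k+1` is recorded by the witness `k`). -/
def Lrel : Language where
  Functions := fun _ => Empty
  Relations := fun m => {k : ℕ // k + 1 = m}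

/-- The atomic formula `ρ_{k+1}(x_{idx 0}, …, x_{idx k})` (variables are the
`N` bound variables of the context). -/
def atomFml {N : ℕ} (k : ℕ) (idx : Fin (k + 1) → Fin N) :
    Lrel.BoundedFormula Empty N :=
  BoundedFormula.rel (⟨k, rfl⟩ : Lrel.Relations (k + 1))
    (fun j => Term.var (Sum.inr (idx j)))

/-- The formula expressing that the `n` variables of the context are pairwise
distinct. -/
noncomputable def distinctFml (n : ℕ) : Lrel.BoundedFormula Empty n :=
  BoundedFormula.iInf fun p : Fin n × Fin n =>
    if p.1 < p.2 then (Term.bdEqual (Term.var (Sum.inr p.1)) (Term.var (Sum.inr p.2))).not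
    else ⊤

/-- (T1) for the `(k+1)`-ary relation symbol:
`∀ x̄ (ρ_{k+1}(x̄) → x̄ pairwise distinct)`. -/
noncomputable def t1Sentence (k : ℕ) : Lrel.Sentence :=
  ((atomFml k id).imp (distinctFml (k + 1))).alls

/-- An atom in the variables `x_0, …, x_n`: a relation symbol of arity
`k+1 ≤ n+1` together with an assignment of variables to its places. -/
abbrev Atom (n : ℕ) : Type := Σ k : Fin (n + 1), (Fin (k.1 + 1) → Fin (n + 1))

/-- A clause in `x_0, …, x_n` is a partial assignment of signs to atoms (so no
literal occurs twice, and no literal occurs both negated and unnegated); it is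
valid if each of its literals uses pairwise distinct variables among which is
`x_0`. -/
def ValidClause {n : ℕ} (K : Atom n → Option Bool) : Prop :=
  ∀ a : Atom n, K a ≠ none → Function.Injective a.2 ∧ ∃ j, a.2 j = 0

/-- Renaming of variables: in the context of `n+1` bound variables, `x_0` is
the innermost (last) variable and `x_1, …, x_n` are the first `n` ones. -/
def vmap (n : ℕ) : Fin (n + 1) → Fin (n + 1) :=
  Fin.cases (Fin.last n) Fin.castSucc

/-- The conjunction of the literals of the clause `K`. -/
noncomputable def clauseFml {n : ℕ} (K : Atom n → Option Bool) :
    Lrel.BoundedFormula Empty (n + 1) :=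
  BoundedFormula.iInf fun a : Atom n =>
    match K a with
    | some true => atomFml a.1.1 (fun j => vmap n (a.2 j))
    | some false => (atomFml a.1.1 (fun j => vmap n (a.2 j))).not
    | none => ⊤

/-- (T2) for the clause `K` in `x_0, …, x_n`:
`∀ x_1 … x_n (x̄ pairwise distinct → ∃ x_0 K(x_0, …, x_n))`. -/
noncomputable def t2Sentence (n : ℕ) (K : Atom n → Option Bool) : Lrel.Sentence :=
  ((distinctFml n).imp (clauseFml K).ex).alls

/-- The theory `T`, consisting of the sentences (T1) and (T2). -/
def TheoryT : Lrel.Theory :=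
  {φ | (∃ k : ℕ, φ = t1Sentence k) ∨
    ∃ (n : ℕ) (K : Atom n → Option Bool), ValidClause K ∧ φ = t2Sentence n K}
section Semantics

theorem snoc_comp_vmap {A : Type*} {n : ℕ} (xs : Fin n → A) (x : A) :
    (Fin.snoc xs x : Fin (n + 1) → A) ∘ vmap n = Fin.cons x xs := by
  funext i
  refine Fin.cases ?_ (fun i => ?_) i <;> simp [vmap]

variable {M : Type} [Lrel.Structure M]

/-- The interpretation of `ρ_{k+1}` in a structure. -/
def Rho (k : ℕ) (y : Fin (k + 1) → M) : Prop :=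
  Structure.RelMap (L := Lrel) (⟨k, rfl⟩ : Lrel.Relations (k + 1)) y

theorem realize_atomFml {N : ℕ} (k : ℕ) (idx : Fin (k + 1) → Fin N) (v : Empty → M)
    (xs : Fin N → M) : (atomFml k idx).Realize v xs ↔ Rho k (xs ∘ idx) :=
  Iff.rfl

theorem realize_distinctFml (n : ℕ) (v : Empty → M) (xs : Fin n → M) :
    (distinctFml n).Realize v xs ↔ Function.Injective xs := by
  rw [distinctFml, BoundedFormula.realize_iInf]
  constructor
  · intro h
    have key : ∀ i j, i < j → xs i ≠ xs j := fun i j hij => by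
      have := h (i, j)
      simpa [hij] using this
    intro i j hij
    by_contra hne
    rcases lt_or_gt_of_ne hne with h' | h'
    · exact key i j h' hij
    · exact key j i h' hij.symm
  · rintro h ⟨i, j⟩
    by_cases hij : i < j
    · simpa [hij] using fun e => hij.ne (h e)
    · simp [hij]

theorem realize_t1Sentence (k : ℕ) :
    M ⊨ t1Sentence k ↔ ∀ y : Fin (k + 1) → M, Rho k y → Function.Injective y := by
  simp only [Sentence.Realize, t1Sentence, BoundedFormula.realize_alls,
    BoundedFormula.realize_imp, realize_distinctFml, realize_atomFml, Function.comp_id]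

theorem realize_clauseFml {n : ℕ} (K : Atom n → Option Bool) (v : Empty → M) (xs : Fin n → M)
    (x : M) :
    (clauseFml K).Realize v (Fin.snoc xs x) ↔ ∀ a : Atom n,
      (K a = some true → Rho a.1.1 ((Fin.cons x xs : Fin (n + 1) → M) ∘ a.2)) ∧
      (K a = some false → ¬ Rho a.1.1 ((Fin.cons x xs : Fin (n + 1) → M) ∘ a.2)) := by
  rw [clauseFml, BoundedFormula.realize_iInf]
  refine forall_congr' fun a => ?_
  rw [← snoc_comp_vmap]
  rcases K a with _ | _ | _
  · simp
  · simp [realize_atomFml, Function.comp_def]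
  · simp [realize_atomFml, Function.comp_def]

theorem realize_t2Sentence {n : ℕ} (K : Atom n → Option Bool) :
    M ⊨ t2Sentence n K ↔ ∀ xs : Fin n → M, Function.Injective xs → ∃ x, ∀ a : Atom n,
      (K a = some true → Rho a.1.1 ((Fin.cons x xs : Fin (n + 1) → M) ∘ a.2)) ∧
      (K a = some false → ¬ Rho a.1.1 ((Fin.cons x xs : Fin (n + 1) → M) ∘ a.2)) := by
  simp only [Sentence.Realize, t2Sentence, BoundedFormula.realize_alls,
    BoundedFormula.realize_imp, BoundedFormula.realize_ex, realize_distinctFml, realize_clauseFml]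

theorem model_theoryT_iff :
    M ⊨ TheoryT ↔
      (∀ (k : ℕ) (y : Fin (k + 1) → M), Rho k y → Function.Injective y) ∧
      ∀ (n : ℕ) (K : Atom n → Option Bool), ValidClause K → ∀ xs : Fin n → M,
        Function.Injective xs → ∃ x, ∀ a : Atom n,
          (K a = some true → Rho a.1.1 ((Fin.cons x xs : Fin (n + 1) → M) ∘ a.2)) ∧
          (K a = some false → ¬ Rho a.1.1 ((Fin.cons x xs : Fin (n + 1) → M) ∘ a.2)) := by
  rw [Theory.model_iff]
  constructor
  · exact fun h => ⟨fun k => (realize_t1Sentence k).1 (h _ (.inl ⟨k, rfl⟩)),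
      fun n K hK => (realize_t2Sentence K).1 (h _ (.inr ⟨n, K, hK, rfl⟩))⟩
  · rintro ⟨h1, h2⟩ φ (⟨k, rfl⟩ | ⟨n, K, hK, rfl⟩)
    · exact (realize_t1Sentence k).2 (h1 k)
    · exact (realize_t2Sentence K).2 (h2 n K hK)

end Semantics

section CountableModel

/-- A tuple of natural numbers together with a clause which an element is asked to satisfy over
that tuple. -/
abbrev ClauseTask : Type := Σ n : ℕ, (Fin n → ℕ) × (Atom n → Option Bool)

instance : Nonempty ClauseTask := ⟨⟨0, Fin.elim0, fun _ => none⟩⟩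

theorem exists_clauseTask_enumeration :
    ∃ f : ℕ → ClauseTask, ∀ (t : ClauseTask) (b : ℕ), ∃ e, b ≤ e ∧ f e = t := by
  obtain ⟨g, hg⟩ := exists_surjective_nat ClauseTask
  refine ⟨fun e => g e.unpair.1, fun t b => ?_⟩
  obtain ⟨c, rfl⟩ := hg t
  exact ⟨Nat.pair c b, Nat.right_le_pair c b, by simp⟩

/-- The task assigned to the element `e`; each task is assigned to arbitrarily large elements. -/
noncomputable def clauseTask : ℕ → ClauseTask := exists_clauseTask_enumeration.choose

theorem exists_clauseTask_eq (t : ClauseTask) (b : ℕ) : ∃ e, b ≤ e ∧ clauseTask e = t :=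
  exists_clauseTask_enumeration.choose_spec t b

/-- The structure on `ℕ` in which a relation holds only of injective tuples, and only if required
by the task of the largest entry of the tuple. -/
noncomputable instance natStructure : Lrel.Structure ℕ where
  funMap := fun f => f.elim
  RelMap := fun {m} _ y => Function.Injective y ∧ ∃ e ∈ Set.range y, (∀ i, y i ≤ e) ∧
    ∃ (a : Atom (clauseTask e).1) (h : m = a.1.1 + 1), (clauseTask e).2.2 a = some true ∧
      ∀ i, y i = (Fin.cons e (clauseTask e).2.1 : Fin ((clauseTask e).1 + 1) → ℕ) (a.2 (Fin.cast h i))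

theorem nat_rho_iff (k : ℕ) (y : Fin (k + 1) → ℕ) :
    Rho k y ↔ Function.Injective y ∧ ∃ e ∈ Set.range y, (∀ i, y i ≤ e) ∧
      ∃ (a : Atom (clauseTask e).1) (h : k + 1 = a.1.1 + 1), (clauseTask e).2.2 a = some true ∧
      ∀ i, y i = (Fin.cons e (clauseTask e).2.1 : Fin ((clauseTask e).1 + 1) → ℕ) (a.2 (Fin.cast h i)) :=
  Iff.rfl

theorem nat_rho_clauseTask_iff {n : ℕ} {xs : Fin n → ℕ} {K : Atom n → Option Bool} {e : ℕ}
    (he : clauseTask e = ⟨n, xs, K⟩) (hxs : Function.Injective xs) (hlt : ∀ i, xs i < e) (a : Atom n)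
    (ha : Function.Injective a.2) (ha0 : ∃ j, a.2 j = 0) :
    Rho a.1.1 ((Fin.cons e xs : Fin (n + 1) → ℕ) ∘ a.2) ↔ K a = some true := by
  have hcons : Function.Injective (Fin.cons e xs : Fin (n + 1) → ℕ) :=
    Fin.cons_injective_iff.2 ⟨by rintro ⟨i, hi⟩; exact (hlt i).ne hi, hxs⟩
  have hle : ∀ i, (Fin.cons e xs : Fin (n + 1) → ℕ) i ≤ e := by
    intro i
    refine Fin.cases ?_ (fun i => ?_) i
    · simp
    · simpa using (hlt i).le
  obtain ⟨j, hj⟩ := ha0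
  have hmem : e ∈ Set.range ((Fin.cons e xs : Fin (n + 1) → ℕ) ∘ a.2) := ⟨j, by simp [hj]⟩
  rw [nat_rho_iff]
  constructor
  · rintro ⟨-, e', ⟨j', hj'⟩, hmax, h⟩
    obtain rfl : e' = e := by
      obtain ⟨i, hi⟩ := hmem
      exact le_antisymm (hj' ▸ hle _) (hi ▸ hmax i)
    rw [he] at h
    obtain ⟨⟨⟨k', hk'⟩, p'⟩, hk, hK, hy⟩ := h
    obtain ⟨⟨k, hk0⟩, p⟩ := a
    obtain rfl : k = k' := by simpa using hk
    obtain rfl : p = p' := by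
      funext i
      exact hcons (hy i)
    exact hK
  · intro hK
    refine ⟨hcons.comp ha, e, hmem, fun i => hle _, ?_⟩
    rw [he]
    exact ⟨a, rfl, hK, fun i => rfl⟩

instance nat_model : ℕ ⊨ TheoryT := by
  refine model_theoryT_iff.2 ⟨fun k y h => ((nat_rho_iff k y).1 h).1, fun n K hK xs hxs => ?_⟩
  obtain ⟨e, hb, he⟩ := exists_clauseTask_eq ⟨n, xs, K⟩ (Finset.univ.sup xs + 1)
  have hlt : ∀ i, xs i < e := fun i =>
    (Finset.le_sup (f := xs) (Finset.mem_univ i)).trans_lt hb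
  refine ⟨e, fun a => ⟨fun h => ?_, fun h => ?_⟩⟩
  · obtain ⟨h1, h2⟩ := hK a (by simp [h])
    exact (nat_rho_clauseTask_iff he hxs hlt a h1 h2).2 h
  · obtain ⟨h1, h2⟩ := hK a (by simp [h])
    rw [nat_rho_clauseTask_iff he hxs hlt a h1 h2, h]
    simp

end CountableModel

section Extension

variable {M N : Type} [Lrel.Structure M] [Lrel.Structure N]

theorem Rho.injective [M ⊨ TheoryT] {k : ℕ} {y : Fin (k + 1) → M} (h : Rho k y) :
    Function.Injective y :=
  (model_theoryT_iff.1 ‹M ⊨ TheoryT›).1 k y h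

theorem exists_rho_cons_iff [M ⊨ TheoryT] {n : ℕ} (xs : Fin n → M) (hxs : Function.Injective xs)
    (Q : ∀ k : ℕ, (Fin (k + 1) → Fin (n + 1)) → Prop) :
    ∃ x, ∀ (k : ℕ) (p : Fin (k + 1) → Fin (n + 1)), Function.Injective p → (∃ j, p j = 0) →
      (Rho k ((Fin.cons x xs : Fin (n + 1) → M) ∘ p) ↔ Q k p) := by
  classical
  obtain ⟨x, hx⟩ := (model_theoryT_iff.1 ‹M ⊨ TheoryT›).2 n
    (fun a => if Function.Injective a.2 ∧ ∃ j, a.2 j = 0 then some (decide (Q a.1 a.2)) else none)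
    (fun a ha => by by_contra h; exact ha (if_neg h)) xs hxs
  refine ⟨x, fun k p hp h0 => ?_⟩
  have hk : k < n + 1 := by
    have := Fintype.card_le_of_injective p hp
    simp only [Fintype.card_fin] at this
    omega
  have := hx ⟨⟨k, hk⟩, p⟩
  simp only [if_pos (And.intro hp h0), Option.some.injEq, decide_eq_true_eq,
    decide_eq_false_iff_not] at this
  exact ⟨fun h => by_contra fun hQ => this.2 hQ h, this.1⟩

theorem exists_rho_elim_iff [M ⊨ TheoryT] {ι : Type} [Finite ι] (xs : ι → M)
    (hxs : Function.Injective xs) (Q : ∀ k : ℕ, (Fin (k + 1) → Option ι) → Prop) :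
    ∃ x, ∀ (k : ℕ) (p : Fin (k + 1) → Option ι), Function.Injective p → (∃ j, p j = none) →
      (Rho k ((fun o => Option.elim o x xs) ∘ p) ↔ Q k p) := by
  obtain ⟨n, ⟨e⟩⟩ := Finite.exists_equiv_fin ι
  let g : Fin (n + 1) → Option ι := Fin.cons none (fun i => some (e.symm i))
  let f : Option ι → Fin (n + 1) := fun o => o.elim 0 (fun i => (e i).succ)
  have hgf : ∀ o, g (f o) = o := by rintro (_ | i) <;> simp [g, f]
  have hf : Function.Injective f := Function.LeftInverse.injective hgf
  obtain ⟨x, hx⟩ := exists_rho_cons_iff (xs ∘ e.symm) (hxs.comp e.symm.injective)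
    (fun k p => Q k (g ∘ p))
  refine ⟨x, fun k p hp ⟨j, hj⟩ => ?_⟩
  have := hx k (f ∘ p) (hf.comp hp) ⟨j, by simp [hj, f]⟩
  convert this using 2
  · funext i
    rcases h : p i with _ | a <;> simp [h, f]
  · funext i
    simp [hgf]

theorem exists_forall_ne [M ⊨ TheoryT] {ι : Type} [Finite ι] (xs : ι → M)
    (hxs : Function.Injective xs) : ∃ x, ∀ i, x ≠ xs i := by
  obtain ⟨x, hx⟩ := exists_rho_elim_iff xs hxs (fun _ _ => True)
  refine ⟨x, fun i hi => ?_⟩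
  have h := (hx 1 ![none, some i] (by simp [Function.Injective, Fin.forall_fin_two])
    ⟨0, rfl⟩).2 trivial
  exact absurd (h.injective (a₁ := 0) (a₂ := 1) (by simpa using hi)) (by simp)

theorem infinite_of_model_theoryT (M : Type) [Lrel.Structure M] [M ⊨ TheoryT] : Infinite M := by
  refine not_finite_iff_infinite.1 fun _ => ?_
  obtain ⟨x, hx⟩ := exists_forall_ne (id : M → M) Function.injective_id
  exact hx x rfl

theorem exists_ne_and_rho_elim_iff [M ⊨ TheoryT] {ι : Type} [Finite ι] (xs : ι → M)
    (hxs : Function.Injective xs) (Q : ∀ k : ℕ, (Fin (k + 1) → Option ι) → Prop) :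
    ∃ x, (∀ i, x ≠ xs i) ∧
      ∀ (k : ℕ) (p : Fin (k + 1) → Option ι), Function.Injective p → (∃ j, p j = none) →
      (Rho k ((fun o => Option.elim o x xs) ∘ p) ↔ Q k p) := by
  obtain ⟨z, hz⟩ := exists_forall_ne xs hxs
  have hzs : Function.Injective (fun o : Option ι => o.elim z xs) := by
    rintro (_ | i) (_ | j) h
    · rfl
    · exact absurd h (hz j)
    · exact absurd h.symm (hz i)
    · exact congrArg some (hxs h)
  obtain ⟨x, hx⟩ := exists_rho_elim_iff (fun o : Option ι => o.elim z xs) hzs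
    (fun k p => (∃ j, p j = some none) ∨ Q k (Option.join ∘ p))
  refine ⟨x, fun i hi => ?_, fun k p hp ⟨j, hj⟩ => ?_⟩
  · have h := (hx 2 ![none, some none, some (some i)]
      (by simp [Function.Injective, Fin.forall_fin_succ]) ⟨0, rfl⟩).2 (Or.inl ⟨1, rfl⟩)
    exact absurd (h.injective (a₁ := 0) (a₂ := 2) (by simpa using hi)) (by simp)
  · have h := hx k (Option.map some ∘ p)
      ((Option.map_injective (Option.some_injective _)).comp hp) ⟨j, by simp [hj]⟩
    have h1 : ¬ ∃ j, (Option.map some ∘ p) j = some (none : Option ι) := by simp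
    have h2 : Option.join ∘ Option.map some ∘ p = p := by
      funext i
      rcases h : p i <;> simp [h]
    rw [h2, or_iff_right h1] at h
    rw [← h]
    congr! 1
    funext i
    rcases h : p i <;> simp [h]

/-- Two families of elements of structures satisfy the same atomic formulas. -/
def Agree {ι : Type} (u : ι → M) (w : ι → N) : Prop :=
  (∀ i j, u i = u j ↔ w i = w j) ∧ ∀ (k : ℕ) (p : Fin (k + 1) → ι), Rho k (u ∘ p) ↔ Rho k (w ∘ p)

theorem Agree.symm {ι : Type} {u : ι → M} {w : ι → N} (h : Agree u w) : Agree w u :=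
  ⟨fun i j => (h.1 i j).symm, fun k p => (h.2 k p).symm⟩

theorem Agree.comp {ι κ : Type} {u : ι → M} {w : ι → N} (h : Agree u w) (f : κ → ι) :
    Agree (u ∘ f) (w ∘ f) :=
  ⟨fun i j => h.1 (f i) (f j), fun k p => h.2 k (f ∘ p)⟩

theorem Agree.exists_elim [M ⊨ TheoryT] [N ⊨ TheoryT] {ι : Type} [Finite ι] {u : ι → M}
    {w : ι → N} (h : Agree u w) (m : M) :
    ∃ y : N, Agree (fun o => Option.elim o m u) (fun o => Option.elim o y w) := by
  by_cases hm : ∃ i, u i = m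
  · obtain ⟨i, rfl⟩ := hm
    refine ⟨w i, ?_⟩
    convert h.comp (fun o : Option ι => o.getD i) using 1 <;>
    · funext o
      cases o <;> rfl
  choose s hs using fun x : Set.range u => x.2
  have hinj : Function.Injective (w ∘ s) := fun x x' e =>
    Subtype.ext (by rw [← hs x, ← hs x']; exact (h.1 _ _).2 e)
  obtain ⟨y, hy, hrho⟩ := exists_ne_and_rho_elim_iff (w ∘ s) hinj
    (fun k p => Rho k ((fun o => Option.elim o m (fun x : Set.range u => (x : M))) ∘ p))
  have hM : Function.Injective (fun o => Option.elim o m (fun x : Set.range u => (x : M))) := by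
    rintro (_ | a) (_ | b) e
    · rfl
    · exact absurd ⟨s b, (hs b).trans e.symm⟩ hm
    · exact absurd ⟨s a, (hs a).trans e⟩ hm
    · exact congrArg some (Subtype.ext e)
  have hN : Function.Injective (fun o => Option.elim o y (w ∘ s)) := by
    rintro (_ | a) (_ | b) e
    · rfl
    · exact absurd e (hy b)
    · exact absurd e.symm (hy a)
    · exact congrArg some (hinj e)
  have key : Agree (fun o => Option.elim o m (fun x : Set.range u => (x : M)))
      (fun o => Option.elim o y (w ∘ s)) := by
    refine ⟨fun i j => hM.eq_iff.trans hN.eq_iff.symm, fun k p => ?_⟩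
    by_cases hp : Function.Injective p
    · by_cases h0 : ∃ j, p j = none
      · exact (hrho k p hp h0).symm
      · have hp' : ∀ j, ∃ x, p j = some x := fun j =>
          Option.ne_none_iff_exists'.1 fun e => h0 ⟨j, e⟩
        choose q hq using hp'
        obtain rfl : p = fun j => some (q j) := funext hq
        convert h.2 k (s ∘ q) using 2
        · funext j
          exact (hs (q j)).symm
        · rfl
    · exact iff_of_false (fun e => hp e.injective.of_comp) (fun e => hp e.injective.of_comp)
  refine ⟨y, ?_⟩
  convert key.comp (Option.map (Set.rangeFactorization u)) using 1
  · funext o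
    cases o <;> rfl
  · funext o
    rcases o with _ | i
    · rfl
    · exact (h.1 _ _).1 (hs (Set.rangeFactorization u i)).symm

end Extension

section QuantifierElimination

open BoundedFormula

theorem Lrel.term_eq_var {β : Type} : ∀ t : Lrel.Term β, ∃ b, t = Term.var b
  | .var b => ⟨b, rfl⟩
  | .func f _ => f.elim

theorem exists_lift_sum {α β κ : Type} (S : Finset α) (c : κ → α ⊕ β)
    (hS : ∀ i a, c i = Sum.inl a → a ∈ S) :
    ∃ c' : κ → S ⊕ β, ∀ i, Sum.map Subtype.val id (c' i) = c i := by
  suffices ∀ i, ∃ d : S ⊕ β, Sum.map Subtype.val id d = c i from Classical.axiomOfChoice this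
  intro i
  rcases h : c i with a | b
  · exact ⟨.inl ⟨a, hS i a h⟩, rfl⟩
  · exact ⟨.inr b, rfl⟩

theorem elim_sum_map_val {α β A : Type} {S : Finset α} (v : α → A) (xs : β → A) (d : S ⊕ β) :
    Sum.elim v xs (Sum.map Subtype.val id d) = Sum.elim (fun s : S => v s) xs d := by
  cases d <;> rfl

theorem Agree.mono {M N α β : Type} [Lrel.Structure M] [Lrel.Structure N] {S S' : Finset α}
    (hS : S ⊆ S') {v : α → M} {xs : β → M} {v' : α → N} {xs' : β → N}
    (h : Agree (Sum.elim (fun s : S' => v s) xs) (Sum.elim (fun s : S' => v' s) xs')) :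
    Agree (Sum.elim (fun s : S => v s) xs) (Sum.elim (fun s : S => v' s) xs') := by
  convert h.comp (Sum.map (fun s : S => (⟨s, hS s.2⟩ : S')) id) using 1 <;>
  · funext d
    cases d <;> rfl

/-- The truth value of a formula in models of `T` is determined by the atomic formulas satisfied by
the values of finitely many variables. -/
theorem exists_finset_realize_iff {α : Type} {n : ℕ} (φ : Lrel.BoundedFormula α n) :
    ∃ S : Finset α, ∀ (M N : Type) [Lrel.Structure M] [Lrel.Structure N] [M ⊨ TheoryT]
      [N ⊨ TheoryT] (v : α → M) (xs : Fin n → M) (v' : α → N) (xs' : Fin n → N),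
      Agree (Sum.elim (fun s : S => v s) xs) (Sum.elim (fun s : S => v' s) xs') →
        (φ.Realize v xs ↔ φ.Realize v' xs') := by
  classical
  induction φ with
  | falsum => exact ⟨∅, fun M N _ _ _ _ v xs v' xs' _ => Iff.rfl⟩
  | equal t₁ t₂ =>
    obtain ⟨b₁, rfl⟩ := Lrel.term_eq_var t₁
    obtain ⟨b₂, rfl⟩ := Lrel.term_eq_var t₂
    obtain ⟨c, hc⟩ := exists_lift_sum ((Finset.univ.image ![b₁, b₂]).toLeft) ![b₁, b₂]
      (fun i a h => by
        rw [Finset.mem_toLeft, ← h]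
        exact Finset.mem_image_of_mem _ (Finset.mem_univ i))
    refine ⟨(Finset.univ.image ![b₁, b₂]).toLeft, fun M N _ _ _ _ v xs v' xs' h => ?_⟩
    have := h.1 (c 0) (c 1)
    simp only [← elim_sum_map_val, hc] at this
    exact this
  | rel R ts =>
    obtain ⟨k, rfl⟩ := R
    choose b hb using fun i => Lrel.term_eq_var (ts i)
    obtain rfl : ts = fun i => Term.var (b i) := funext hb
    obtain ⟨c, hc⟩ := exists_lift_sum ((Finset.univ.image b).toLeft) b
      (fun i a h => by
        rw [Finset.mem_toLeft, ← h]
        exact Finset.mem_image_of_mem _ (Finset.mem_univ i))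
    refine ⟨(Finset.univ.image b).toLeft, fun M N _ _ _ _ v xs v' xs' h => ?_⟩
    have := h.2 k c
    simp only [Function.comp_def, ← elim_sum_map_val, hc] at this
    exact this
  | imp φ ψ ih₁ ih₂ =>
    obtain ⟨S₁, h₁⟩ := ih₁
    obtain ⟨S₂, h₂⟩ := ih₂
    refine ⟨S₁ ∪ S₂, fun M N _ _ _ _ v xs v' xs' h => ?_⟩
    rw [realize_imp, realize_imp, h₁ M N v xs v' xs' (h.mono Finset.subset_union_left),
      h₂ M N v xs v' xs' (h.mono Finset.subset_union_right)]
  | @all n φ ih =>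
    obtain ⟨S, hS⟩ := ih
    have step : ∀ (M N : Type) [Lrel.Structure M] [Lrel.Structure N] [M ⊨ TheoryT]
        [N ⊨ TheoryT] (v : α → M) (xs : Fin n → M) (v' : α → N) (xs' : Fin n → N),
        Agree (Sum.elim (fun s : S => v s) xs) (Sum.elim (fun s : S => v' s) xs') →
          φ.all.Realize v xs → φ.all.Realize v' xs' := by
      intro M N _ _ _ _ v xs v' xs' h hφ y
      obtain ⟨m, hm⟩ := h.symm.exists_elim y
      refine (hS M N v (Fin.snoc xs m) v' (Fin.snoc xs' y) ?_).1 (hφ m)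
      convert hm.symm.comp (Sum.elim (fun s => some (Sum.inl s))
        (Fin.snoc (α := fun _ => Option (S ⊕ Fin n)) (fun i => some (Sum.inr i)) none)) using 1 <;>
      · funext d
        rcases d with s | i
        · rfl
        · refine Fin.lastCases ?_ (fun i => ?_) i <;> simp
    exact ⟨S, fun M N _ _ _ _ v xs v' xs' h =>
      ⟨step M N v xs v' xs' h, step N M v' xs' v xs h.symm⟩⟩

theorem isQF_foldr_sup {L : FirstOrder.Language} {α : Type}
    {n : ℕ} {l : List (L.BoundedFormula α n)}
    (h : ∀ φ ∈ l, φ.IsQF) : (l.foldr (· ⊔ ·) ⊥).IsQF := by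
  induction l with
  | nil => exact isQF_bot
  | cons φ l ih =>
    exact (h φ (by simp)).sup (ih fun ψ hψ => h ψ (by simp [hψ]))

theorem isQF_foldr_inf {L : FirstOrder.Language} {α : Type}
    {n : ℕ} {l : List (L.BoundedFormula α n)}
    (h : ∀ φ ∈ l, φ.IsQF) : (l.foldr (· ⊓ ·) ⊤).IsQF := by
  induction l with
  | nil => exact IsQF.top
  | cons φ l ih =>
    exact (h φ (by simp)).inf (ih fun ψ hψ => h ψ (by simp [hψ]))

theorem isQF_iSup {L : FirstOrder.Language} {α β : Type} [Finite β] {n : ℕ}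
    {f : β → L.BoundedFormula α n} (h : ∀ b, (f b).IsQF) : (BoundedFormula.iSup f).IsQF :=
  isQF_foldr_sup (by simpa using h)

theorem isQF_iInf {L : FirstOrder.Language} {α β : Type} [Finite β] {n : ℕ}
    {f : β → L.BoundedFormula α n} (h : ∀ b, (f b).IsQF) : (BoundedFormula.iInf f).IsQF :=
  isQF_foldr_inf (by simpa using h)

/-- A formula whose truth value in models of a theory is determined by those of finitely many
quantifier-free formulas is equivalent to a quantifier-free formula. -/
theorem exists_isQF_of_finite_determined {L : FirstOrder.Language.{0, 0}} {T : L.Theory}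
    {α A : Type} [Finite A] {n : ℕ} (φ : L.BoundedFormula α n) (θ : A → L.BoundedFormula α n)
    (hθ : ∀ a, (θ a).IsQF)
    (h : ∀ (M N : Theory.ModelType.{0, 0, 0} T) (v : α → M) (xs : Fin n → M) (v' : α → N)
      (xs' : Fin n → N), (∀ a, (θ a).Realize v xs ↔ (θ a).Realize v' xs') →
        φ.Realize v xs → φ.Realize v' xs') :
    ∃ ψ : L.BoundedFormula α n, ψ.IsQF ∧
      ∀ (M : Theory.ModelType.{0, 0, 0} T) (v : α → M) (xs : Fin n → M),
        φ.Realize v xs ↔ ψ.Realize v xs := by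
  classical
  let P : (A → Prop) → Prop := fun c => ∃ (M : Theory.ModelType.{0, 0, 0} T) (v : α → M)
    (xs : Fin n → M), φ.Realize v xs ∧ ∀ a, (θ a).Realize v xs ↔ c a
  refine ⟨BoundedFormula.iSup fun c : {c // P c} =>
    BoundedFormula.iInf fun a => if c.1 a then θ a else (θ a).not, ?_, fun M v xs => ?_⟩
  · refine isQF_iSup fun c => isQF_iInf fun a => ?_
    split_ifs
    exacts [hθ a, (hθ a).not]
  · rw [realize_iSup]
    simp only [realize_iInf]
    constructor
    · intro hφ
      refine ⟨⟨fun a => (θ a).Realize v xs, M, v, xs, hφ, fun a => Iff.rfl⟩, fun a => ?_⟩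
      dsimp only
      split_ifs with ha
      exacts [ha, realize_not.2 ha]
    · rintro ⟨⟨c, N, v', xs', hφ, hc⟩, hM⟩
      refine h N M v' xs' v xs (fun a => (hc a).trans ?_) hφ
      have := hM a
      dsimp only at this
      split_ifs at this with ha
      exacts [iff_of_true ha this, iff_of_false ha (realize_not.1 this)]

theorem theoryT_quantifier_elimination {α : Type} {n : ℕ} (φ : Lrel.BoundedFormula α n) :
    ∃ ψ : Lrel.BoundedFormula α n, ψ.IsQF ∧
      ∀ (M : Theory.ModelType.{0, 0, 0} TheoryT) (v : α → M) (xs : Fin n → M),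
        φ.Realize v xs ↔ ψ.Realize v xs := by
  obtain ⟨S, hS⟩ := exists_finset_realize_iff φ
  let g : S ⊕ Fin n → Lrel.Term (α ⊕ Fin n) := fun d => Term.var (Sum.map Subtype.val id d)
  let θ : ((S ⊕ Fin n) × (S ⊕ Fin n)) ⊕
      (Σ k : Fin (Fintype.card (S ⊕ Fin n)), Fin (k.1 + 1) → S ⊕ Fin n) →
      Lrel.BoundedFormula α n := Sum.elim (fun d => (g d.1).bdEqual (g d.2))
    (fun r => BoundedFormula.rel (⟨r.1.1, rfl⟩ : Lrel.Relations (r.1.1 + 1)) fun i => g (r.2 i))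
  have hθ₁ : ∀ (M : Theory.ModelType.{0, 0, 0} TheoryT) (v : α → M) (xs : Fin n → M) (i j),
      (θ (.inl (i, j))).Realize v xs ↔
        Sum.elim (fun s : S => v s) xs i = Sum.elim (fun s : S => v s) xs j := by
    intro M v xs i j
    rw [← elim_sum_map_val, ← elim_sum_map_val]
    exact Iff.rfl
  have hθ₂ : ∀ (M : Theory.ModelType.{0, 0, 0} TheoryT) (v : α → M) (xs : Fin n → M) (r),
      (θ (.inr r)).Realize v xs ↔ Rho r.1.1 (Sum.elim (fun s : S => v s) xs ∘ r.2) := by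
    intro M v xs r
    simp only [Function.comp_def, ← elim_sum_map_val]
    exact Iff.rfl
  refine exists_isQF_of_finite_determined φ θ ?_ fun M N v xs v' xs' h =>
    (hS M N v xs v' xs' ⟨fun i j => ?_, fun k p => ?_⟩).1
  · rintro (d | r)
    exacts [(IsAtomic.equal _ _).isQF, (IsAtomic.rel _ _).isQF]
  · rw [← hθ₁, ← hθ₁, h]
  · by_cases hp : Function.Injective p
    · have hk : k < Fintype.card (S ⊕ Fin n) := by
        have := Fintype.card_le_of_injective p hp
        rw [Fintype.card_fin] at this
        omega
      have := h (.inr ⟨⟨k, hk⟩, p⟩)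
      rwa [hθ₂, hθ₂] at this
    · exact iff_of_false (fun e => hp e.injective.of_comp) (fun e => hp e.injective.of_comp)

theorem theoryT_isSatisfiable : TheoryT.IsSatisfiable :=
  Theory.Model.isSatisfiable ℕ

theorem theoryT_isComplete : TheoryT.IsComplete := by
  refine ⟨theoryT_isSatisfiable, fun φ => ?_⟩
  obtain ⟨S, hS⟩ := exists_finset_realize_iff φ
  have key : ∀ M N : Theory.ModelType.{0, 0, 0} TheoryT, M ⊨ φ → N ⊨ φ := fun M N =>
    (hS M N default default default default
      ⟨fun i => isEmptyElim i, fun k p => isEmptyElim (p 0)⟩).1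
  simp only [Theory.models_sentence_iff, Sentence.realize_not]
  by_contra! h
  obtain ⟨⟨M, hM⟩, N, hN⟩ := h
  exact hM (key N M hN)

end QuantifierElimination

section Categoricity

variable {M N : Type} [Lrel.Structure M] [Lrel.Structure N]

/-- The finite partial isomorphisms between two structures, given by their graphs. -/
abbrev FinitePartialIso (M N : Type) [Lrel.Structure M] [Lrel.Structure N] : Type :=
  {S : Finset (M × N) // Agree (fun s : S => s.1.1) (fun s : S => s.1.2)}

theorem agree_insert [DecidableEq (M × N)] {S : Finset (M × N)} {m : M} {y : N}
    (h : Agree (fun o => Option.elim o m fun s : S => s.1.1)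
      (fun o => Option.elim o y fun s : S => s.1.2)) :
    Agree (fun s : (insert (m, y) S : Finset (M × N)) => s.1.1)
      (fun s : (insert (m, y) S : Finset (M × N)) => s.1.2) := by
  have : ∀ s : (insert (m, y) S : Finset (M × N)), ∃ o : Option S,
      o.elim (m, y) Subtype.val = s.1 := by
    rintro ⟨s, hs⟩
    rcases Finset.mem_insert.1 hs with rfl | hs
    exacts [⟨none, rfl⟩, ⟨some ⟨s, hs⟩, rfl⟩]
  choose f hf using this
  convert h.comp f using 1 <;>
  · funext s
    rw [← hf s]
    rcases h' : f s <;> simp [h']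

variable [M ⊨ TheoryT] [N ⊨ TheoryT]

/-- The finite partial isomorphisms whose domain contains a given element. -/
def FinitePartialIso.definedAtLeft (N : Type) [Lrel.Structure N] [N ⊨ TheoryT] (m : M) :
    Order.Cofinal (FinitePartialIso M N) where
  carrier := {S | ∃ y, (m, y) ∈ S.1}
  isCofinal S := by
    classical
    obtain ⟨y, hy⟩ := S.2.exists_elim m
    exact ⟨⟨insert (m, y) S.1, agree_insert hy⟩, ⟨y, Finset.mem_insert_self _ _⟩,
      Finset.subset_insert _ _⟩

/-- The finite partial isomorphisms whose codomain contains a given element. -/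
def FinitePartialIso.definedAtRight (M : Type) [Lrel.Structure M] [M ⊨ TheoryT] (y : N) :
    Order.Cofinal (FinitePartialIso M N) where
  carrier := {S | ∃ m, (m, y) ∈ S.1}
  isCofinal S := by
    classical
    obtain ⟨m, hm⟩ := S.2.symm.exists_elim y
    exact ⟨⟨insert (m, y) S.1, agree_insert hm.symm⟩, ⟨m, Finset.mem_insert_self _ _⟩,
      Finset.subset_insert _ _⟩

open FinitePartialIso in
theorem nonempty_equiv_of_countable_models [Countable M] [Countable N] :
    Nonempty (M ≃[Lrel] N) := by
  classical
  cases nonempty_encodable M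
  cases nonempty_encodable N
  let D : M ⊕ N → Order.Cofinal (FinitePartialIso M N) :=
    Sum.elim (definedAtLeft N) (definedAtRight M)
  let S₀ : FinitePartialIso M N :=
    ⟨∅, fun i => (Finset.notMem_empty _ i.2).elim, fun k p =>
      (Finset.notMem_empty _ (p 0).2).elim⟩
  let I := Order.idealOfCofinals S₀ D
  have hF : ∀ m, ∃ y, ∃ S ∈ I, (m, y) ∈ S.1 := fun m => by
    obtain ⟨S, ⟨y, hy⟩, hS⟩ := Order.cofinal_meets_idealOfCofinals S₀ D (.inl m)
    exact ⟨y, S, hS, hy⟩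
  have hG : ∀ y, ∃ m, ∃ S ∈ I, (m, y) ∈ S.1 := fun y => by
    obtain ⟨S, ⟨m, hm⟩, hS⟩ := Order.cofinal_meets_idealOfCofinals S₀ D (.inr y)
    exact ⟨m, S, hS, hm⟩
  have hagree : Agree (fun s : {s : M × N // ∃ S ∈ I, s ∈ S.1} => s.1.1) (fun s => s.1.2) := by
    have hdir : ∀ (n : ℕ) (p : Fin n → {s : M × N // ∃ S ∈ I, s ∈ S.1}),
        ∃ S ∈ I, ∀ i, (p i).1 ∈ S.1 := by
      intro n p
      choose T hT hpT using fun i => (p i).2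
      have := I.nonempty.to_subtype
      obtain ⟨⟨S, hS⟩, hle⟩ := (directedOn_iff_directed.1 I.directed).finite_le
        (fun i => ⟨T i, hT i⟩)
      exact ⟨S, hS, fun i => hle i (hpT i)⟩
    refine ⟨fun i j => ?_, fun k p => ?_⟩
    · obtain ⟨S, -, h⟩ := hdir 2 ![i, j]
      exact S.2.1 ⟨i.1, h 0⟩ ⟨j.1, h 1⟩
    · obtain ⟨S, -, h⟩ := hdir _ p
      exact S.2.2 k fun i => ⟨(p i).1, h i⟩
  choose F hF using hF
  choose G hG using hG
  refine ⟨⟨⟨F, G, fun m => ?_, fun y => ?_⟩, fun f => f.elim, ?_⟩⟩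
  · exact (hagree.1 ⟨(G (F m), F m), hG _⟩ ⟨(m, F m), hF m⟩).2 rfl
  · exact (hagree.1 ⟨(G y, F (G y)), hF _⟩ ⟨(G y, y), hG y⟩).1 rfl
  · rintro _ ⟨k, rfl⟩ x
    exact (hagree.2 k fun i => ⟨(x i, F (x i)), hF _⟩).symm

end Categoricity

/-- The theory `T` (1) is consistent and has no finite
models, (2) has elimination of quantifiers (every formula is, modulo `T`,
equivalent to a quantifier-free formula), (3) is complete, and (4) is
ω-categorical (it has, up to isomorphism, exactly one countable model). -/
theorem stmt14 :
    TheoryT.IsSatisfiable ∧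
    (∀ M : Language.Theory.ModelType.{0, 0, 0} TheoryT, Infinite M) ∧
    (∀ (α : Type) (n : ℕ) (φ : Lrel.BoundedFormula α n),
      ∃ ψ : Lrel.BoundedFormula α n, ψ.IsQF ∧
        ∀ (M : Language.Theory.ModelType.{0, 0, 0} TheoryT) (v : α → M) (xs : Fin n → M),
          φ.Realize v xs ↔ ψ.Realize v xs) ∧
    TheoryT.IsComplete ∧
    ((∃ M : Language.Theory.ModelType.{0, 0, 0} TheoryT, Cardinal.mk M = Cardinal.aleph0) ∧
      Cardinal.Categorical.{0, 0, 0} Cardinal.aleph0 TheoryT) := by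
  refine ⟨theoryT_isSatisfiable, fun M => infinite_of_model_theoryT (M : Type),
    fun α n φ => theoryT_quantifier_elimination φ, theoryT_isComplete,
    ⟨Theory.ModelType.of TheoryT ℕ, Cardinal.mk_nat⟩, fun M N hM hN => ?_⟩
  have := Cardinal.mk_le_aleph0_iff.1 hM.le
  have := Cardinal.mk_le_aleph0_iff.1 hN.le
  exact nonempty_equiv_of_countable_models
end

section
/- If 𝐌 and 𝐍 are models of the theory T and 𝐍 is a substructure of 𝐌, then 𝐍 is an elementary substructure of 𝐌: for every L-formula φ(x_1,…,x_n) and every tuple a ∈ N^n, φ(a) holds in 𝐍 if and only if it holds in 𝐌. -/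
open FirstOrder

open FirstOrder.Language

namespace Lrel

universe u v w

variable {A : Type u} {B : Type v} [Lrel.Structure A] [Lrel.Structure B]

/-- The interpretation of the `(k+1)`-ary relation symbol. -/
def Rho (A : Type u) [Lrel.Structure A] (k : ℕ) (x : Fin (k + 1) → A) : Prop :=
  Structure.RelMap (L := Lrel) (M := A) (n := k + 1) ⟨k, rfl⟩ x

theorem realize_atomFml {N k : ℕ} {idx : Fin (k + 1) → Fin N} {e : Empty → A} {xs : Fin N → A} :
    (atomFml k idx).Realize e xs ↔ Rho A k (xs ∘ idx) :=
  Iff.rfl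

theorem realize_distinctFml {n : ℕ} {e : Empty → A} {xs : Fin n → A} :
    (distinctFml n).Realize e xs ↔ Function.Injective xs := by
  rw [distinctFml, BoundedFormula.realize_iInf]
  constructor
  · intro h i j hij
    by_contra hne
    rcases lt_or_gt_of_ne hne with hlt | hlt
    · have := h (i, j)
      rw [if_pos hlt, BoundedFormula.realize_not, BoundedFormula.realize_bdEqual] at this
      exact this hij
    · have := h (j, i)
      rw [if_pos hlt, BoundedFormula.realize_not, BoundedFormula.realize_bdEqual] at this
      exact this hij.symm
  · rintro h ⟨i, j⟩
    split_ifs with hlt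
    · rw [BoundedFormula.realize_not, BoundedFormula.realize_bdEqual]
      exact fun hij => hlt.ne (h hij)
    · exact BoundedFormula.realize_top.2 trivial

theorem snoc_comp_vmap {X : Type*} {n : ℕ} (b : Fin n → X) (d : X) :
    (Fin.snoc b d : Fin (n + 1) → X) ∘ vmap n = Fin.cons d b := by
  funext i
  refine Fin.cases ?_ (fun i => ?_) i <;> simp [vmap]

theorem Rho.injective (hA : A ⊨ TheoryT) {k : ℕ} {x : Fin (k + 1) → A} (h : Rho A k x) :
    Function.Injective x := by
  have h₁ : A ⊨ t1Sentence k := hA.realize_of_mem _ (Or.inl ⟨k, rfl⟩)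
  have h₂ := BoundedFormula.realize_alls.1 h₁ x
  rw [BoundedFormula.realize_imp, realize_atomFml, realize_distinctFml] at h₂
  exact h₂ h

/-- All relations between a new element and a given injective tuple may be prescribed. -/
theorem exists_rho_iff (hA : A ⊨ TheoryT) {n : ℕ} {b : Fin n → A} (hb : Function.Injective b)
    (P : ∀ k, (Fin (k + 1) → Fin (n + 1)) → Prop) :
    ∃ d, ∀ k f, Function.Injective f → (∃ j, f j = 0) →
      (Rho A k ((Fin.cons d b : Fin (n + 1) → A) ∘ f) ↔ P k f) := by
  classical
  let K : Atom n → Option Bool := fun a =>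
    if Function.Injective a.2 ∧ ∃ j, a.2 j = 0 then some (decide (P a.1 a.2)) else none
  have hK : ValidClause K := fun a ha => by
    by_contra h
    exact ha (if_neg h)
  have h₁ : A ⊨ t2Sentence n K := hA.realize_of_mem _ (Or.inr ⟨n, K, hK, rfl⟩)
  have h₂ := BoundedFormula.realize_alls.1 h₁ b
  rw [BoundedFormula.realize_imp, realize_distinctFml, BoundedFormula.realize_ex] at h₂
  obtain ⟨d, hd⟩ := h₂ hb
  refine ⟨d, fun k f hf h0 => ?_⟩
  have hk : k < n + 1 := by simpa using Fintype.card_le_of_injective f hf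
  rw [clauseFml, BoundedFormula.realize_iInf] at hd
  have h₃ := hd ⟨⟨k, hk⟩, f⟩
  have hKf : K ⟨⟨k, hk⟩, f⟩ = some (decide (P k f)) := if_pos ⟨hf, h0⟩
  rw [hKf] at h₃
  have hatom := realize_atomFml (e := (default : Empty → A)) (xs := Fin.snoc b d)
    (idx := fun j => vmap n (f j))
  rw [← snoc_comp_vmap]
  by_cases hP : P k f
  · rw [decide_eq_true hP] at h₃
    exact iff_of_true (hatom.1 h₃) hP
  · rw [decide_eq_false hP] at h₃
    exact iff_of_false (fun h => h₃ (hatom.2 h)) hP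

/-- The element realizing prescribed relations may be chosen outside the given tuple. -/
theorem exists_notMem_range_rho_iff (hA : A ⊨ TheoryT) {n : ℕ} {b : Fin n → A}
    (hb : Function.Injective b) (P : ∀ k, (Fin (k + 1) → Fin (n + 1)) → Prop) :
    ∃ d, d ∉ Set.range b ∧ ∀ k f, Function.Injective f → (∃ j, f j = 0) →
      (Rho A k ((Fin.cons d b : Fin (n + 1) → A) ∘ f) ↔ P k f) := by
  obtain ⟨c, hc⟩ := exists_rho_iff hA hb fun _ _ => True
  have hcb : Function.Injective (Fin.cons c b : Fin (n + 1) → A) :=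
    ((hc n id Function.injective_id ⟨0, rfl⟩).2 trivial).injective hA
  have hbc : Function.Injective (Fin.snoc b c : Fin (n + 1) → A) :=
    Fin.snoc_injective_iff.2 ⟨hb, (Fin.cons_injective_iff.1 hcb).1⟩
  obtain ⟨d, hd⟩ := exists_rho_iff hA hbc fun k f =>
    ∀ g : Fin (k + 1) → Fin (n + 1), f = Fin.castSucc ∘ g → P k g
  have hdbc : Function.Injective (Fin.cons d (Fin.snoc b c) : Fin (n + 2) → A) := by
    refine ((hd (n + 1) id Function.injective_id ⟨0, rfl⟩).2 fun g hg => ?_).injective hA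
    exact absurd (congrFun hg (Fin.last _)).symm (Fin.castSucc_ne_last _)
  refine ⟨d, ?_, fun k f hf h0 => ?_⟩
  · rintro ⟨i, rfl⟩
    exact (Fin.cons_injective_iff.1 hdbc).1 ⟨i.castSucc, by simp⟩
  · have hcomp : (Fin.cons d (Fin.snoc b c) : Fin (n + 2) → A) ∘ (Fin.castSucc ∘ f)
        = (Fin.cons d b : Fin (n + 1) → A) ∘ f := by
      rw [Fin.cons_snoc_eq_snoc_cons]
      funext i
      simp
    have := hd k (Fin.castSucc ∘ f) ((Fin.castSucc_injective _).comp hf)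
      (h0.imp fun j hj => by simp [hj])
    rw [hcomp] at this
    rw [this]
    refine ⟨fun h => h f rfl, fun h g hg => ?_⟩
    rwa [← (Fin.castSucc_injective _).comp_left hg]

/-- Two families of elements have the same quantifier-free type. -/
structure SameType {ι : Type w} (x : ι → A) (y : ι → B) : Prop where
  eq_iff : ∀ i j, x i = x j ↔ y i = y j
  rho_iff : ∀ k (f : Fin (k + 1) → ι), Rho A k (x ∘ f) ↔ Rho B k (y ∘ f)

namespace SameType

variable {ι : Type w} {x : ι → A} {y : ι → B}

theorem symm (h : SameType x y) : SameType y x :=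
  ⟨fun i j => (h.eq_iff i j).symm, fun k f => (h.rho_iff k f).symm⟩

theorem comp {κ : Type*} (h : SameType x y) (p : κ → ι) : SameType (x ∘ p) (y ∘ p) :=
  ⟨fun i j => h.eq_iff (p i) (p j), fun k f => h.rho_iff k (p ∘ f)⟩

theorem exists_cons (hA : A ⊨ TheoryT) (hB : B ⊨ TheoryT) {n : ℕ} {a : Fin n → A} {b : Fin n → B}
    (h : SameType a b) (ha : Function.Injective a) {c : A} (hc : c ∉ Set.range a) :
    ∃ d : B, SameType (Fin.cons c a : Fin (n + 1) → A) (Fin.cons d b : Fin (n + 1) → B) := by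
  have hb : Function.Injective b := fun i j hij => ha ((h.eq_iff i j).2 hij)
  obtain ⟨d, hd, hrho⟩ := exists_notMem_range_rho_iff hB hb fun k f =>
    Rho A k ((Fin.cons c a : Fin (n + 1) → A) ∘ f)
  have hca : Function.Injective (Fin.cons c a : Fin (n + 1) → A) :=
    Fin.cons_injective_iff.2 ⟨hc, ha⟩
  have hdb : Function.Injective (Fin.cons d b : Fin (n + 1) → B) :=
    Fin.cons_injective_iff.2 ⟨hd, hb⟩
  refine ⟨d, fun i j => hca.eq_iff.trans hdb.eq_iff.symm, fun k f => ?_⟩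
  by_cases hf : Function.Injective f
  · by_cases h0 : ∃ j, f j = 0
    · exact (hrho k f hf h0).symm
    · push Not at h0
      choose g hg using fun j => Fin.exists_succ_eq.2 (h0 j)
      obtain rfl : f = Fin.succ ∘ g := funext fun j => (hg j).symm
      exact h.rho_iff k g
  · exact iff_of_false (fun h' => hf (h'.injective hA).of_comp)
      fun h' => hf (h'.injective hB).of_comp

theorem exists_option_elim [Finite ι] (hA : A ⊨ TheoryT) (hB : B ⊨ TheoryT) (h : SameType x y)
    (c : A) : ∃ d : B, SameType (fun o : Option ι => o.elim c x) (fun o => o.elim d y) := by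
  by_cases hc : c ∈ Set.range x
  · obtain ⟨i, rfl⟩ := hc
    refine ⟨y i, ?_⟩
    convert h.comp (fun o : Option ι => o.elim i id) using 1 <;>
    · funext o
      cases o <;> rfl
  · obtain ⟨n, ⟨σ⟩⟩ := Finite.exists_equiv_fin (Set.range x)
    choose e he using fun j : Fin n => (σ.symm j).2
    have hinj : Function.Injective (x ∘ e) := fun i j hij =>
      σ.symm.injective (Subtype.ext ((he i).symm.trans (hij.trans (he j))))
    obtain ⟨d, hd⟩ := (h.comp e).exists_cons hA hB hinj (c := c)
      fun ⟨j, hj⟩ => hc ⟨e j, hj⟩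
    let q : ι → Fin n := fun i => σ ⟨x i, i, rfl⟩
    have hq : ∀ i, x (e (q i)) = x i := fun i => by rw [he]; simp [q]
    refine ⟨d, ?_⟩
    convert hd.comp (fun o : Option ι => o.elim 0 fun i => (q i).succ) using 1
    · funext o
      cases o with
      | none => rfl
      | some i => exact (hq i).symm
    · funext o
      cases o with
      | none => rfl
      | some i => exact ((h.eq_iff _ _).1 (hq i)).symm

theorem exists_snoc {α : Type w} [Finite α] {n : ℕ} {v : α → A} {v' : α → B} {xs : Fin n → A}
    {xs' : Fin n → B} (hA : A ⊨ TheoryT) (hB : B ⊨ TheoryT)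
    (h : SameType (Sum.elim v xs) (Sum.elim v' xs')) (c : A) :
    ∃ d : B, SameType (Sum.elim v (Fin.snoc xs c : Fin (n + 1) → A))
      (Sum.elim v' (Fin.snoc xs' d : Fin (n + 1) → B)) := by
  obtain ⟨d, hd⟩ := h.exists_option_elim hA hB c
  refine ⟨d, ?_⟩
  let p : α ⊕ Fin (n + 1) → Option (α ⊕ Fin n) :=
    Sum.elim (fun i => some (Sum.inl i))
      (Fin.snoc (α := fun _ => Option (α ⊕ Fin n)) (fun j => some (Sum.inr j)) none)
  convert hd.comp p using 1 <;>
  · funext i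
    rcases i with i | i
    · rfl
    · refine Fin.lastCases ?_ (fun j => ?_) i <;> simp [p]

/-- Families with the same quantifier-free type in models of `TheoryT` satisfy the same
formulas. -/
theorem realize_iff {α : Type w} [Finite α] (hA : A ⊨ TheoryT) (hB : B ⊨ TheoryT) {n : ℕ}
    (φ : Lrel.BoundedFormula α n) {v : α → A} {v' : α → B} {xs : Fin n → A} {xs' : Fin n → B}
    (h : SameType (Sum.elim v xs) (Sum.elim v' xs')) : φ.Realize v xs ↔ φ.Realize v' xs' := by
  have hvar : ∀ {m : ℕ} (t : Lrel.Term (α ⊕ Fin m)), ∃ i, t = Term.var i := fun t => by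
    cases t with
    | var i => exact ⟨i, rfl⟩
    | func f _ => exact f.elim
  induction φ with
  | falsum => exact Iff.rfl
  | equal t₁ t₂ =>
    obtain ⟨i, rfl⟩ := hvar t₁
    obtain ⟨j, rfl⟩ := hvar t₂
    exact h.eq_iff i j
  | rel R ts =>
    obtain ⟨k, rfl⟩ := R
    choose f hf using fun j => hvar (ts j)
    obtain rfl : ts = fun j => Term.var (f j) := funext hf
    exact h.rho_iff k f
  | imp φ ψ ihφ ihψ => exact imp_congr (ihφ h) (ihψ h)
  | all φ ih =>
    constructor
    · intro hφ d
      obtain ⟨c, hc⟩ := h.symm.exists_snoc hB hA d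
      exact (ih hc.symm).1 (hφ c)
    · intro hφ c
      obtain ⟨d, hd⟩ := h.exists_snoc hA hB c
      exact (ih hd).2 (hφ d)

end SameType

end Lrel

/-- If `M` and `N` are models of the theory `T` and `N` is a
substructure of `M`, then `N` is an elementary substructure of `M`: for every
formula `φ(x_1, …, x_n)` and every tuple `a` from `N`, `φ(a)` holds in `N` iff
it holds in `M`. -/
theorem stmt15 (M : Type) [Lrel.Structure M] (hM : M ⊨ TheoryT)
    (N : Lrel.Substructure M) (hN : (N : Type) ⊨ TheoryT) :
    ∀ (n : ℕ) (φ : Lrel.Formula (Fin n)) (a : Fin n → N),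
      φ.Realize a ↔ φ.Realize (fun i => (a i : M)) := by
  intro n φ a
  refine Lrel.SameType.realize_iff hN hM φ ⟨?_, fun k f => ?_⟩
  · rintro (i | i) (j | j)
    · exact Subtype.ext_iff
    all_goals first | exact i.elim0 | exact j.elim0
  · have hsub := N.subtype.map_rel (n := k + 1) ⟨k, rfl⟩
      (Sum.elim a (default : Fin 0 → N) ∘ f)
    refine hsub.symm.trans (iff_of_eq (congrArg (Lrel.Rho M k) ?_))
    funext j
    simp only [Function.comp_apply]
    rcases f j with i | i
    · rfl
    · exact i.elim0
end
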